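/- Let Q be an IP-polygon with maximal local index m_Q = k ≥ 2. Then the number of boundary lattice points satisfies |∂Q ∩ ℤ²| ≤ 4k(k + 2). -/

import Mathlib

open Pointwise

/-- The embedding of the lattice `ℤ²` into `ℚ²`. -/
def toQ (p : ℤ × ℤ) : ℚ × ℚ := ((p.1 : ℚ), (p.2 : ℚ))

/-- The pairing between the dual lattice `ℤ²` and `ℚ²`. -/
def pairQ (η : ℤ × ℤ) (x : ℚ × ℚ) : ℚ := (η.1 : ℚ) * x.1 + (η.2 : ℚ) * x.2

/-- A lattice polygon: the convex hull of finitely many lattice points,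
with nonempty interior. -/
def IsLatticePolygon (Q : Set (ℚ × ℚ)) : Prop :=
  (∃ S : Finset (ℤ × ℤ), Q = convexHull ℚ (toQ '' (S : Set (ℤ × ℤ)))) ∧
    (interior Q).Nonempty

/-- An IP-polygon: a lattice polygon containing the origin in its interior. -/
def IsIPPolygon (Q : Set (ℚ × ℚ)) : Prop :=
  IsLatticePolygon Q ∧ (0 : ℚ × ℚ) ∈ interior Q

/-- The vertices of a polygon are its extreme points. -/
def vertices (Q : Set (ℚ × ℚ)) : Set (ℚ × ℚ) := Set.extremePoints ℚ Q

/-- An LDP-polygon: an IP-polygon all of whose vertices are primitive lattice points. -/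
def IsLDPPolygon (Q : Set (ℚ × ℚ)) : Prop :=
  IsIPPolygon Q ∧ ∀ v ∈ vertices Q, ∃ p : ℤ × ℤ, Int.gcd p.1 p.2 = 1 ∧ v = toQ p

/-- `IsFacetWith Q η l F` : `F` is a facet (edge) of `Q` with primitive outer normal
`η` and local index `l`, i.e. `⟨η, x⟩ = l` on `F` and `⟨η, y⟩ ≤ l` on `Q`. -/
def IsFacetWith (Q : Set (ℚ × ℚ)) (η : ℤ × ℤ) (l : ℤ) (F : Set (ℚ × ℚ)) : Prop :=
  Int.gcd η.1 η.2 = 1 ∧ 0 < l ∧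
  (∀ y ∈ Q, pairQ η y ≤ (l : ℚ)) ∧
  F = {x ∈ Q | pairQ η x = (l : ℚ)} ∧
  ∃ x ∈ F, ∃ y ∈ F, x ≠ y

/-- `F` is a facet of `Q`. -/
def IsFacet (Q F : Set (ℚ × ℚ)) : Prop := ∃ η l, IsFacetWith Q η l F

/-- `HasMaxLocalIndex Q k` : the maximal local index `m_Q` of `Q` equals `k`. -/
def HasMaxLocalIndex (Q : Set (ℚ × ℚ)) (k : ℤ) : Prop :=
  (∃ F η, IsFacetWith Q η k F) ∧ ∀ F η l, IsFacetWith Q η l F → l ≤ k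

/-- `HasIndex Q ℓ` : the index `ℓ_Q` of `Q` (the lcm of all local indices) equals `ℓ`. -/
def HasIndex (Q : Set (ℚ × ℚ)) (ℓ : ℤ) : Prop :=
  0 < ℓ ∧ (∀ F η l, IsFacetWith Q η l F → l ∣ ℓ) ∧
  ∀ m : ℤ, 0 < m → (∀ F η l, IsFacetWith Q η l F → l ∣ m) → ℓ ∣ m

/-- The only lattice point in the interior of `(1/k)·Q` is the origin. -/
def NoIntLatticePts (Q : Set (ℚ × ℚ)) (k : ℤ) : Prop :=
  ∀ p : ℤ × ℤ, toQ p ∈ interior (((k : ℚ)⁻¹) • Q) → p = 0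

/-- `HasOrder Q I` : the order `o_Q` of `Q` equals `I`. -/
def HasOrder (Q : Set (ℚ × ℚ)) (I : ℤ) : Prop :=
  1 ≤ I ∧ NoIntLatticePts Q I ∧ ∀ k : ℤ, 1 ≤ k → NoIntLatticePts Q k → I ≤ k

/-- The cone `pos(F) = ℝ≥0·F` spanned by `F` (inside `ℚ²`). -/
def posCone (F : Set (ℚ × ℚ)) : Set (ℚ × ℚ) :=
  {y | ∃ t : ℚ, 0 ≤ t ∧ ∃ z ∈ F, y = t • z}

/-- The number of lattice points in a subset of `ℚ²`. -/
noncomputable def latticeCount (S : Set (ℚ × ℚ)) : ℕ :=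
  {p : ℤ × ℤ | toQ p ∈ S}.ncard

/-- The normalised volume of `Q`: twice the Euclidean area of the corresponding
real region. -/
noncomputable def nVol (Q : Set (ℚ × ℚ)) : ℝ :=
  2 * (MeasureTheory.volume
    (closure ((fun x : ℚ × ℚ => ((x.1 : ℝ), (x.2 : ℝ))) '' Q))).toReal

/-- Unimodular equivalence: `Q'` is the image of `Q` under an element of `GL(2,ℤ)`. -/
def UnimodEquiv (Q Q' : Set (ℚ × ℚ)) : Prop :=
  ∃ a b c d : ℤ, (a * d - b * c = 1 ∨ a * d - b * c = -1) ∧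
    (fun x : ℚ × ℚ => ((a : ℚ) * x.1 + (b : ℚ) * x.2,
      (c : ℚ) * x.1 + (d : ℚ) * x.2)) '' Q = Q'


/-- The determinant of two lattice vectors. -/
def dt (p q : ℤ × ℤ) : ℤ := p.1 * q.2 - p.2 * q.1

lemma exists_initial_pair (S : Finset (ℤ × ℤ)) (v : ℤ × ℤ) (hv : v ≠ 0)
    (hS : ∀ a b : ℤ, (a, b) ≠ (0, 0) → ∃ s ∈ S, 0 < a * s.1 + b * s.2) :
    ∃ p ∈ S, ∃ q ∈ S, 0 < dt p q ∧ 0 < dt v q ∧ 0 ≤ dt p v := by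
  have hv' : (-v.2, v.1) ≠ ((0 : ℤ), (0 : ℤ)) := by
    intro h
    apply hv
    simp only [Prod.mk.injEq, neg_eq_zero] at h
    exact Prod.ext h.2 h.1
  obtain ⟨s0, hs0, hs0'⟩ := hS _ _ hv'
  have hne : (S.filter (fun s => 0 < dt v s)).Nonempty :=
    ⟨s0, Finset.mem_filter.2 ⟨hs0, by unfold dt; linarith⟩⟩
  obtain ⟨q, hq, hqmax⟩ := Finset.exists_max_image _
    (fun s : ℤ × ℤ => ((v.1 * s.1 + v.2 * s.2 : ℤ) : ℚ) / ((dt v s : ℤ) : ℚ)) hne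
  rw [Finset.mem_filter] at hq
  obtain ⟨hqS, hqv⟩ := hq
  have hq' : (q.2, -q.1) ≠ ((0 : ℤ), (0 : ℤ)) := by
    intro h
    simp only [Prod.mk.injEq, neg_eq_zero] at h
    unfold dt at hqv
    rw [h.1, h.2] at hqv
    simp at hqv
  obtain ⟨p, hpS, hp⟩ := hS _ _ hq'
  refine ⟨p, hpS, q, hqS, by unfold dt; linarith, hqv, ?_⟩
  by_contra hneg
  have hpv : 0 < dt v p := by unfold dt at *; linarith
  have h1 := hqmax p (Finset.mem_filter.2 ⟨hpS, hpv⟩)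
  have a1 : (0 : ℚ) < ((dt v p : ℤ) : ℚ) := by exact_mod_cast hpv
  have a2 : (0 : ℚ) < ((dt v q : ℤ) : ℚ) := by exact_mod_cast hqv
  rw [div_le_div_iff₀ a1 a2] at h1
  have h2 : (v.1 * p.1 + v.2 * p.2) * dt v q ≤ (v.1 * q.1 + v.2 * q.2) * dt v p := by
    exact_mod_cast h1
  have h3 : (v.1 * p.1 + v.2 * p.2) * dt v q - (v.1 * q.1 + v.2 * q.2) * dt v p
      = (v.1 ^ 2 + v.2 ^ 2) * (p.1 * q.2 - p.2 * q.1) := by unfold dt; ring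
  have h4 : 0 < v.1 ^ 2 + v.2 ^ 2 := by
    by_contra hc
    apply hv
    have e1 : v.1 = 0 := by nlinarith [sq_nonneg v.1, sq_nonneg v.2]
    have e2 : v.2 = 0 := by nlinarith [sq_nonneg v.1, sq_nonneg v.2]
    exact Prod.ext e1 e2
  have h5 : 0 < p.1 * q.2 - p.2 * q.1 := by linarith
  nlinarith [mul_pos h4 h5]

/-- Every nonzero direction lies in the cone over a supporting edge. -/
lemma exists_edge (S : Finset (ℤ × ℤ)) (v : ℤ × ℤ) (hv : v ≠ 0)
    (hS : ∀ a b : ℤ, (a, b) ≠ (0, 0) → ∃ s ∈ S, 0 < a * s.1 + b * s.2) :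
    ∃ p ∈ S, ∃ q ∈ S, 0 < dt p q ∧ 0 < dt v q ∧ 0 ≤ dt p v ∧
      ∀ s ∈ S, dt s q + dt p s ≤ dt p q := by
  set w : ℤ × ℤ := (-v.2, v.1) with hw
  set P := (S ×ˢ S).filter (fun z => 0 < dt z.1 z.2 ∧ 0 < dt v z.2 ∧ 0 ≤ dt z.1 v) with hP
  have memP : ∀ z, z ∈ P ↔ (z.1 ∈ S ∧ z.2 ∈ S) ∧
      (0 < dt z.1 z.2 ∧ 0 < dt v z.2 ∧ 0 ≤ dt z.1 v) := by
    intro z; rw [hP, Finset.mem_filter, Finset.mem_product]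
  let cost : (ℤ × ℤ) → (ℤ × ℤ) × (ℤ × ℤ) → ℚ := fun u z =>
    ((dt u z.2 + dt z.1 u : ℤ) : ℚ) / ((dt z.1 z.2 : ℤ) : ℚ)
  have costle : ∀ u z z', 0 < dt z.1 z.2 → 0 < dt z'.1 z'.2 → cost u z ≤ cost u z' →
      (dt u z.2 + dt z.1 u) * dt z'.1 z'.2 ≤ (dt u z'.2 + dt z'.1 u) * dt z.1 z.2 := by
    intro u z z' h1 h2 h
    have a1 : (0 : ℚ) < ((dt z.1 z.2 : ℤ) : ℚ) := by exact_mod_cast h1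
    have a2 : (0 : ℚ) < ((dt z'.1 z'.2 : ℤ) : ℚ) := by exact_mod_cast h2
    simp only [cost] at h
    rw [div_le_div_iff₀ a1 a2] at h
    exact_mod_cast h
  obtain ⟨p0, hp0, q0, hq0, h0⟩ := exists_initial_pair S v hv hS
  have hne : P.Nonempty := ⟨(p0, q0), (memP _).2 ⟨⟨hp0, hq0⟩, h0⟩⟩
  obtain ⟨z0, hz0, hmin0⟩ := Finset.exists_min_image P (cost v) hne
  have hne1 : (P.filter (fun z => cost v z = cost v z0)).Nonempty :=
    ⟨z0, Finset.mem_filter.2 ⟨hz0, rfl⟩⟩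
  obtain ⟨⟨p, q⟩, hz, hmin1⟩ := Finset.exists_min_image _ (cost w) hne1
  rw [Finset.mem_filter] at hz
  obtain ⟨hzP, hzc⟩ := hz
  obtain ⟨⟨hp, hq⟩, hD, hα, hβ⟩ := (memP _).1 hzP
  simp only at hp hq hD hα hβ
  refine ⟨p, hp, q, hq, hD, hα, hβ, ?_⟩
  intro s hs
  by_contra hcon
  push Not at hcon
  have i1 : dt p q * dt v s = dt p s * dt v q - dt s q * dt p v := by unfold dt; ring
  have i2 : dt p q * dt s v = dt s q * dt p v - dt p s * dt v q := by unfold dt; ring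
  by_cases hc : dt s q * dt p v < dt p s * dt v q
  · have hB : 0 < dt p s := by
      by_contra hB
      push Not at hB
      have : dt s q * dt p v < 0 := by nlinarith
      have : dt s q < 0 := by
        by_contra hh
        push Not at hh
        nlinarith [mul_nonneg hh hβ]
      linarith
    have hvs : 0 < dt v s := by
      by_contra hh
      push Not at hh
      nlinarith
    have hmem : (p, s) ∈ P := (memP _).2 ⟨⟨hp, hs⟩, hB, hvs, hβ⟩
    have hle : cost v (p, q) ≤ cost v (p, s) := hzc ▸ hmin0 _ hmem
    have hle' := costle _ _ _ hD hB hle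
    simp only at hle'
    have hb0 : dt p v = 0 := by
      by_contra hb
      have hb : 0 < dt p v := lt_of_le_of_ne hβ (Ne.symm hb)
      nlinarith [mul_pos hb (sub_pos.2 hcon)]
    have hle2 : cost v (p, s) ≤ cost v (p, q) := by
      have a1 : (0 : ℚ) < ((dt p s : ℤ) : ℚ) := by exact_mod_cast hB
      have a2 : (0 : ℚ) < ((dt p q : ℤ) : ℚ) := by exact_mod_cast hD
      simp only [cost]
      rw [div_le_div_iff₀ a1 a2]
      have : (dt v s + dt p v) * dt p q ≤ (dt v q + dt p v) * dt p s := by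
        rw [hb0] at i1 ⊢; nlinarith
      exact_mod_cast this
    have hw1 := costle _ _ _ hD hB (hmin1 (p, s) (Finset.mem_filter.2
      ⟨hmem, (le_antisymm hle2 hle).trans hzc⟩))
    simp only at hw1
    have hpw : 0 < dt p w := by
      have e : dt p q * dt v w = dt v q * dt p w + dt p v * dt q w := by unfold dt; ring
      have h4 : 0 < dt v w := by
        by_contra hc
        apply hv
        simp only [dt, hw] at hc
        have e1 : v.1 = 0 := by nlinarith [sq_nonneg v.1, sq_nonneg v.2]
        have e2 : v.2 = 0 := by nlinarith [sq_nonneg v.1, sq_nonneg v.2]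
        exact Prod.ext e1 e2
      rw [hb0] at e
      by_contra hh
      push Not at hh
      nlinarith [mul_pos hD h4]
    have i3 : dt p q * dt w s = dt p s * dt w q - dt s q * dt p w := by unfold dt; ring
    nlinarith [mul_pos hpw (sub_pos.2 hcon)]
  · push Not at hc
    have hA : 0 < dt s q := by
      by_contra hB
      push Not at hB
      have h1 : dt p s * dt v q ≤ 0 := by nlinarith
      have : dt p s ≤ 0 := by
        by_contra hh
        push Not at hh
        nlinarith [mul_pos hh hα]
      linarith
    have hsv : 0 ≤ dt s v := by
      by_contra hh
      push Not at hh
      nlinarith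
    have hmem : (s, q) ∈ P := (memP _).2 ⟨⟨hs, hq⟩, hA, hα, hsv⟩
    have hle : cost v (p, q) ≤ cost v (s, q) := hzc ▸ hmin0 _ hmem
    have hle' := costle _ _ _ hD hA hle
    simp only at hle'
    nlinarith [mul_pos hα (sub_pos.2 hcon)]

lemma card_le_of_diam (A : Finset ℤ) (d : ℤ) (hd : 0 ≤ d + 1)
    (h : ∀ x ∈ A, ∀ y ∈ A, y - x ≤ d) : (A.card : ℤ) ≤ d + 1 := by
  rcases A.eq_empty_or_nonempty with rfl | hne
  · simpa using hd
  · have hsub : A ⊆ Finset.Icc (A.min' hne) (A.max' hne) := fun x hx =>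
      Finset.mem_Icc.2 ⟨A.min'_le x hx, A.le_max' x hx⟩
    have h1 := Finset.card_le_card hsub
    rw [Int.card_Icc] at h1
    have h2 := h _ (A.min'_mem hne) _ (A.max'_mem hne)
    omega

lemma sum_aux (M : ℕ) : ∑ i ∈ Finset.range M, (2 * ((i : ℤ) + 1)) = M * (M + 1) := by
  induction M with
  | zero => simp
  | succ n ih => rw [Finset.sum_range_succ, ih]; push_cast; ring

/-- The combinatorial counting statement in adapted coordinates. -/
lemma count_bound (B : Finset (ℤ × ℤ)) (k l h : ℤ) (hl : 0 < l) (hlk : l ≤ k) (hh : 0 < h)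
    (htop : ∀ b ∈ B, b.2 ≤ l) (hbot : ∀ b ∈ B, -h ≤ b.2)
    (hT : ∃ b ∈ B, b.2 = l) (hB : ∃ b ∈ B, b.2 = -h)
    (hrow : ∀ j, -h < j → j < l → (B.filter (fun b => b.2 = j)).card ≤ 2)
    (hw : ∀ P ∈ B, ∀ P' ∈ B, ∀ R ∈ B, ∀ R' ∈ B, P.2 = l → P'.2 = l → R.2 = -h → R'.2 = -h →
      h * (P'.1 - P.1) + l * (R'.1 - R.1) ≤ 2 * k * (l + h))
    (hsum : 0 ≤ ∑ b ∈ B, b.2) : (B.card : ℤ) ≤ 4 * k * (k + 2) := by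
  -- diameters of top and bottom rows
  have diam : ∀ j, (∃ b ∈ B, b.2 = j) → ∃ P ∈ B, ∃ P' ∈ B, P.2 = j ∧ P'.2 = j ∧
      0 ≤ P'.1 - P.1 ∧ ((B.filter (fun b => b.2 = j)).card : ℤ) ≤ P'.1 - P.1 + 1 := by
    intro j ⟨b, hb, hbj⟩
    have hne : (B.filter (fun b => b.2 = j)).Nonempty := ⟨b, Finset.mem_filter.2 ⟨hb, hbj⟩⟩
    obtain ⟨P, hP, hPm⟩ := Finset.exists_min_image _ Prod.fst hne
    obtain ⟨P', hP', hPm'⟩ := Finset.exists_max_image _ Prod.fst hne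
    have hPP := hPm P' hP'
    have hinj : Set.InjOn Prod.fst (B.filter (fun b => b.2 = j) : Set (ℤ × ℤ)) := by
      intro x hx y hy hxy
      rw [Finset.mem_coe, Finset.mem_filter] at hx hy
      exact Prod.ext hxy (hx.2.trans hy.2.symm)
    have hc := card_le_of_diam ((B.filter (fun b => b.2 = j)).image Prod.fst) (P'.1 - P.1)
      (by linarith) (by
        intro x hx y hy
        obtain ⟨x', hx', rfl⟩ := Finset.mem_image.1 hx
        obtain ⟨y', hy', rfl⟩ := Finset.mem_image.1 hy
        have := hPm x' hx'
        have := hPm' y' hy'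
        linarith)
    rw [Finset.card_image_of_injOn hinj] at hc
    rw [Finset.mem_filter] at hP hP'
    exact ⟨P, hP.1, P', hP'.1, hP.2, hP'.2, by linarith, hc⟩
  obtain ⟨P, hP, P', hP', hPl, hPl', hf0, hf⟩ := diam l hT
  obtain ⟨R, hR, R', hR', hRl, hRl', hm0, hm⟩ := diam (-h) hB
  have key := hw P hP P' hP' R hR R' hR' hPl hPl' hRl hRl'
  generalize P'.1 - P.1 = f at *
  generalize R'.1 - R.1 = m at *
  by_cases hlh : l ≤ h
  · -- weigh the points with `l + y`
    have hpos : (l * B.card : ℤ) ≤ ∑ b ∈ B, (l + b.2) := by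
      rw [Finset.sum_add_distrib, Finset.sum_const, nsmul_eq_mul]
      linarith [mul_comm l (B.card : ℤ)]
    obtain ⟨L, rfl⟩ : ∃ L : ℕ, l = L := ⟨l.toNat, by omega⟩
    have hle : ∑ b ∈ B, ((L : ℤ) + b.2) ≤
        ∑ b ∈ B.filter (fun b => -(L : ℤ) < b.2), ((L : ℤ) + b.2) := by
      rw [Finset.sum_filter]
      apply Finset.sum_le_sum
      intro b _
      split_ifs with hc <;> linarith
    have hfib : ∑ b ∈ B.filter (fun b => -(L : ℤ) < b.2), ((L : ℤ) + b.2) =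
        ∑ i ∈ Finset.range (2 * L), ∑ b ∈ (B.filter (fun b => -(L : ℤ) < b.2)).filter
          (fun b : ℤ × ℤ => (b.2 + (L : ℤ) - 1).toNat = i), ((L : ℤ) + b.2) := by
      rw [Finset.sum_fiberwise_of_maps_to]
      intro b hb
      rw [Finset.mem_filter] at hb
      have := htop b hb.1
      rw [Finset.mem_range]
      omega
    have hinner : ∀ i ∈ Finset.range (2 * L),
        ∑ b ∈ (B.filter (fun b => -(L : ℤ) < b.2)).filter
          (fun b : ℤ × ℤ => (b.2 + (L : ℤ) - 1).toNat = i), ((L : ℤ) + b.2) =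
        ((B.filter (fun b => b.2 = (i : ℤ) + 1 - L)).card : ℤ) * (i + 1) := by
      intro i _
      have heq : (B.filter (fun b => -(L : ℤ) < b.2)).filter
          (fun b : ℤ × ℤ => (b.2 + (L : ℤ) - 1).toNat = i) = B.filter (fun b => b.2 = (i : ℤ) + 1 - L) := by
        ext b
        simp only [Finset.mem_filter]
        constructor
        · rintro ⟨⟨h1, h2⟩, h3⟩
          exact ⟨h1, by omega⟩
        · rintro ⟨h1, h2⟩
          exact ⟨⟨h1, by omega⟩, by omega⟩
      rw [heq, Finset.sum_congr rfl (g := fun _ => (i : ℤ) + 1), Finset.sum_const, nsmul_eq_mul]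
      intro b hb
      rw [Finset.mem_filter] at hb
      rw [hb.2]; ring
    rw [hfib, Finset.sum_congr rfl hinner] at hle
    obtain ⟨M, hM⟩ : ∃ M, 2 * L = M + 1 := ⟨2 * L - 1, by omega⟩
    rw [hM, Finset.sum_range_succ] at hle
    have hmid : ∑ i ∈ Finset.range M,
        ((B.filter (fun b => b.2 = (i : ℤ) + 1 - L)).card : ℤ) * (i + 1) ≤
        ∑ i ∈ Finset.range M, (2 * ((i : ℤ) + 1)) := by
      apply Finset.sum_le_sum
      intro i hi
      rw [Finset.mem_range] at hi
      have := hrow ((i : ℤ) + 1 - L) (by omega) (by omega)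
      have h2 : ((B.filter (fun b => b.2 = (i : ℤ) + 1 - L)).card : ℤ) ≤ 2 := by
        exact_mod_cast this
      exact mul_le_mul_of_nonneg_right h2 (by positivity)
    rw [sum_aux] at hmid
    have hMe : (M : ℤ) + 1 - L = L := by omega
    have hMe' : (M : ℤ) = 2 * L - 1 := by omega
    rw [hMe] at hle
    rw [hMe'] at hle hmid
    have h2 := mul_le_mul_of_nonneg_right hf (show (0 : ℤ) ≤ 2 * L by positivity)
    have h3 : (L : ℤ) * B.card ≤ L * (2 * (f + 2 * L)) := by nlinarith
    have h4 : (B.card : ℤ) ≤ 2 * (f + 2 * L) := le_of_mul_le_mul_left h3 hl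
    have h5 : f ≤ 4 * k := by
      by_contra hc
      push Not at hc
      nlinarith [mul_nonneg hl.le hm0, mul_lt_mul_of_pos_left hc hh]
    nlinarith
  · push Not at hlh
    have hcard : (B.card : ℤ) = ∑ j ∈ Finset.Icc (-h) l,
        ((B.filter (fun b => b.2 = j)).card : ℤ) := by
      have := Finset.card_eq_sum_card_fiberwise (f := Prod.snd) (s := B)
        (t := Finset.Icc (-h) l) (by
          intro b hb
          exact Finset.mem_coe.2 (Finset.mem_Icc.2 ⟨hbot b hb, htop b hb⟩))
      exact_mod_cast this
    have hsplit : Finset.Icc (-h) l = insert (-h) (insert l (Finset.Ioo (-h) l)) := by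
      ext j
      simp only [Finset.mem_Icc, Finset.mem_insert, Finset.mem_Ioo]
      omega
    rw [hsplit, Finset.sum_insert (by
      simp only [Finset.mem_insert, Finset.mem_Ioo]; omega), Finset.sum_insert (by
      simp only [Finset.mem_Ioo]; omega)] at hcard
    have hmid : ∑ j ∈ Finset.Ioo (-h) l, ((B.filter (fun b => b.2 = j)).card : ℤ) ≤
        ∑ j ∈ Finset.Ioo (-h) l, 2 := by
      apply Finset.sum_le_sum
      intro j hj
      rw [Finset.mem_Ioo] at hj
      exact_mod_cast hrow j hj.1 hj.2
    rw [Finset.sum_const, Int.card_Ioo, nsmul_eq_mul] at hmid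
    have hN : (((l - -h - 1).toNat : ℕ) : ℤ) = l + h - 1 := by omega
    rw [hN] at hmid
    have hTle : (B.card : ℤ) ≤ f + m + 2 * (l + h) := by linarith
    have h1 : h * (B.card : ℤ) ≤ 2 * (k + h) * (l + h) := by
      nlinarith [mul_le_mul_of_nonneg_left hTle hh.le, mul_nonneg hm0 (sub_nonneg.2 hlh.le)]
    have h2 : (k + h) * (l + h) ≤ (k + h) * (k + h) :=
      mul_le_mul_of_nonneg_left (by linarith) (by linarith)
    have h3 : (k + h) * (k + h) ≤ h * (2 * k * (k + 2)) := by
      have : h ≤ k := by linarith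
      have e1 : 0 ≤ (h - 1) * k ^ 2 := mul_nonneg (by linarith) (by positivity)
      have e2 : 0 ≤ h * (k - h) := mul_nonneg hh.le (by linarith)
      have e3 : 0 ≤ h * k := mul_nonneg hh.le (by linarith)
      have e4 : 0 ≤ h * k ^ 2 := mul_nonneg hh.le (by positivity)
      nlinarith
    have h4 : h * (B.card : ℤ) ≤ h * (4 * k * (k + 2)) := by nlinarith
    exact le_of_mul_le_mul_left h4 hh

set_option maxHeartbeats 1000000 in
/-- Purely arithmetic version of the theorem. -/
lemma core_bound (B : Finset (ℤ × ℤ)) (k : ℤ) (hB0 : (0 : ℤ × ℤ) ∉ B)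
    (hA : ∀ v : ℤ × ℤ, v ≠ 0 → ∃ e1 e2 l : ℤ, ∃ p ∈ B, ∃ q ∈ B, ∃ a c d : ℤ,
      (∃ r s : ℤ, e1 * r + e2 * s = 1) ∧ 0 < l ∧ l ≤ k ∧
      (∀ b ∈ B, e1 * b.1 + e2 * b.2 ≤ l) ∧
      e1 * p.1 + e2 * p.2 = l ∧ e1 * q.1 + e2 * q.2 = l ∧
      0 ≤ a ∧ 0 ≤ c ∧ 0 < d ∧ d * v.1 = a * p.1 + c * q.1 ∧ d * v.2 = a * p.2 + c * q.2 ∧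
      0 < e1 * v.1 + e2 * v.2 ∧
      (v ∈ B → e1 * v.1 + e2 * v.2 = l)) : (B.card : ℤ) ≤ 4 * k * (k + 2) := by
  -- special facet
  have hspec : ∃ e1 e2 l : ℤ, ∃ p ∈ B, (∃ r s : ℤ, e1 * r + e2 * s = 1) ∧ 0 < l ∧ l ≤ k ∧
      (∀ b ∈ B, e1 * b.1 + e2 * b.2 ≤ l) ∧ e1 * p.1 + e2 * p.2 = l ∧
      0 ≤ ∑ b ∈ B, (e1 * b.1 + e2 * b.2) := by
    have hlin : ∀ e1 e2 : ℤ, ∑ b ∈ B, (e1 * b.1 + e2 * b.2) =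
        e1 * (∑ b ∈ B, b).1 + e2 * (∑ b ∈ B, b).2 := by
      intro e1 e2
      rw [Finset.sum_add_distrib, ← Finset.mul_sum, ← Finset.mul_sum, Prod.fst_sum, Prod.snd_sum]
    by_cases hv : (∑ b ∈ B, b) = 0
    · obtain ⟨e1, e2, l, p, hp, q, hq, a, c, d, h1, h2, h3, h4, h5, -⟩ := hA (1, 0) (by simp)
      exact ⟨e1, e2, l, p, hp, h1, h2, h3, h4, h5, by rw [hlin, hv]; simp⟩
    · obtain ⟨e1, e2, l, p, hp, q, hq, a, c, d, h1, h2, h3, h4, h5, -, -, -, -, -, -, h6, -⟩ :=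
        hA _ hv
      exact ⟨e1, e2, l, p, hp, h1, h2, h3, h4, h5, by rw [hlin]; exact h6.le⟩
  obtain ⟨e1, e2, l, p, hp, ⟨r, s, hrs⟩, hl, hlk, htop, hpl, hsum⟩ := hspec
  -- a boundary point of negative height
  have hneg : ∃ b ∈ B, e1 * b.1 + e2 * b.2 < 0 := by
    by_contra hcon
    push Not at hcon
    obtain ⟨_, _, _, p1, hp1, q1, hq1, a, c, d, -, -, -, -, -, -, ha, hc, hd, hd1, hd2, -, -⟩ :=
      hA (-r, -s) (by
        intro h0
        simp only [Prod.mk_eq_zero, neg_eq_zero] at h0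
        rw [h0.1, h0.2] at hrs
        simp at hrs)
    simp only at hd1 hd2
    have e : -d = a * (e1 * p1.1 + e2 * p1.2) + c * (e1 * q1.1 + e2 * q1.2) := by
      linear_combination (-d) * hrs.symm + e1 * hd1 + e2 * hd2
    nlinarith [mul_nonneg ha (hcon p1 hp1), mul_nonneg hc (hcon q1 hq1)]
  obtain ⟨b0, hb0, hb0min⟩ := Finset.exists_min_image B (fun b => e1 * b.1 + e2 * b.2) ⟨p, hp⟩
  obtain ⟨b1, hb1, hb1n⟩ := hneg
  have hmin := hb0min b1 hb1
  obtain ⟨h, hh⟩ : ∃ h, h = -(e1 * b0.1 + e2 * b0.2) := ⟨_, rfl⟩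
  have hhpos : 0 < h := by linarith
  -- change of coordinates
  let ψ : ℤ × ℤ → ℤ × ℤ := fun b => (-s * b.1 + r * b.2, e1 * b.1 + e2 * b.2)
  have inv1 : ∀ b : ℤ × ℤ, b.1 = (e1 * b.1 + e2 * b.2) * r - (-s * b.1 + r * b.2) * e2 := by
    intro b; linear_combination (-b.1) * hrs
  have inv2 : ∀ b : ℤ × ℤ, b.2 = (e1 * b.1 + e2 * b.2) * s + (-s * b.1 + r * b.2) * e1 := by
    intro b; linear_combination (-b.2) * hrs
  have hinj : Function.Injective ψ := by
    intro x y hxy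
    simp only [ψ, Prod.mk.injEq] at hxy
    apply Prod.ext
    · rw [inv1 x, inv1 y, hxy.1, hxy.2]
    · rw [inv2 x, inv2 y, hxy.1, hxy.2]
  have hcardψ : (B.image ψ).card = B.card := Finset.card_image_of_injective _ hinj
  rw [← hcardψ]
  -- bound along the direction `u = (-e2, e1)`
  have hu : (-e2, e1) ≠ (0 : ℤ × ℤ) := by
    intro h0
    simp only [Prod.mk_eq_zero, neg_eq_zero] at h0
    rw [h0.1, h0.2] at hrs
    simp at hrs
  have hu' : (e2, -e1) ≠ (0 : ℤ × ℤ) := by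
    intro h0
    simp only [Prod.mk_eq_zero, neg_eq_zero] at h0
    rw [h0.1, h0.2] at hrs
    simp at hrs
  have hwid : ∀ P ∈ B, ∀ R ∈ B, e1 * P.1 + e2 * P.2 = l → e1 * R.1 + e2 * R.2 = -h →
      h * (-s * P.1 + r * P.2) + l * (-s * R.1 + r * R.2) ≤ k * (l + h) ∧
      -(h * (-s * P.1 + r * P.2) + l * (-s * R.1 + r * R.2)) ≤ k * (l + h) := by
    intro P hP R hR hPl hRl
    have gen : ∀ g1 g2 l' : ℤ, ∀ X : ℤ, l' ≤ k → (g1 * P.1 + g2 * P.2 ≤ l') →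
        (g1 * R.1 + g2 * R.2 ≤ l') → ∀ t : ℤ, 0 < t →
        X * t = h * (g1 * P.1 + g2 * P.2) + l * (g1 * R.1 + g2 * R.2) → X ≤ k * (l + h) := by
      intro g1 g2 l' X hl' h1 h2 t ht hX
      have h3 : X * t ≤ k * (l + h) := by
        rw [hX]
        nlinarith [mul_le_mul_of_nonneg_left (h1.trans hl') hhpos.le,
          mul_le_mul_of_nonneg_left (h2.trans hl') hl.le]
      have hk0 : 0 ≤ k * (l + h) := mul_nonneg (by linarith) (by linarith)
      by_cases hX0 : X ≤ 0
      · linarith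
      · push Not at hX0
        nlinarith
    have p1 := inv1 P
    have p2 := inv2 P
    have r1 := inv1 R
    have r2 := inv2 R
    rw [hPl] at p1 p2
    rw [hRl] at r1 r2
    constructor
    · obtain ⟨g1, g2, l', _, _, _, _, _, _, _, -, -, hl', htop', -, -, -, -, -, -, -, ht, -⟩ :=
        hA _ hu
      refine gen g1 g2 l' _ hl' (htop' P hP) (htop' R hR) _ ht ?_
      simp only
      linear_combination (-h * g1) * p1 + (-h * g2) * p2 + (-l * g1) * r1 + (-l * g2) * r2
    · obtain ⟨g1, g2, l', _, _, _, _, _, _, _, -, -, hl', htop', -, -, -, -, -, -, -, ht, -⟩ :=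
        hA _ hu'
      refine gen g1 g2 l' _ hl' (htop' P hP) (htop' R hR) _ ht ?_
      simp only
      linear_combination (-h * g1) * p1 + (-h * g2) * p2 + (-l * g1) * r1 + (-l * g2) * r2
  -- three collinear points
  have hthree : ∀ x ∈ B, ∀ y ∈ B, ∀ z ∈ B, ∀ j, -h < j → j < l →
      e1 * x.1 + e2 * x.2 = j → e1 * y.1 + e2 * y.2 = j → e1 * z.1 + e2 * z.2 = j →
      -s * x.1 + r * x.2 < -s * y.1 + r * y.2 → -s * y.1 + r * y.2 < -s * z.1 + r * z.2 →
      False := by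
    intro x hx y hy z hz j hj1 hj2 hxj hyj hzj hxy hyz
    have hy0 : y ≠ 0 := fun h0 => hB0 (h0 ▸ hy)
    obtain ⟨g1, g2, l', _, _, _, _, _, _, _, -, hl', -, htop', -, -, -, -, -, -, -, ht, hyl⟩ :=
        hA y hy0
    have hyl := hyl hy
    have hxl := htop' x hx
    have hzl := htop' z hz
    have hpl' := htop' p hp
    have hbl' := htop' b0 hb0
    have hgen : ∀ b : ℤ × ℤ, g1 * b.1 + g2 * b.2 = (e1 * b.1 + e2 * b.2) * (g1 * r + g2 * s) +
        (-s * b.1 + r * b.2) * (g2 * e1 - g1 * e2) := by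
      intro b
      linear_combination g1 * inv1 b + g2 * inv2 b
    rw [hgen, hyj] at hyl
    rw [hgen, hxj] at hxl
    rw [hgen, hzj] at hzl
    rw [hgen, hpl] at hpl'
    rw [hgen, show e1 * b0.1 + e2 * b0.2 = -h by linarith] at hbl'
    generalize g1 * r + g2 * s = c at *
    have ht0 : g2 * e1 - g1 * e2 = 0 := by
      generalize g2 * e1 - g1 * e2 = t at *
      apply le_antisymm
      · by_contra hc
        push Not at hc
        nlinarith
      · by_contra hc
        push Not at hc
        nlinarith
    rw [ht0] at hyl hpl' hbl'
    simp only [mul_zero, add_zero] at hyl hpl' hbl'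
    have c1 : c ≤ 0 := by
      by_contra hc
      push Not at hc
      nlinarith
    have c2 : 0 ≤ c := by
      by_contra hc
      push Not at hc
      nlinarith
    have c3 : c = 0 := le_antisymm c1 c2
    rw [c3] at hyl
    simp at hyl
    omega
  have hthree' : ∀ x ∈ B.image ψ, ∀ y ∈ B.image ψ, ∀ z ∈ B.image ψ, ∀ j, -h < j → j < l →
      x.2 = j → y.2 = j → z.2 = j → x.1 < y.1 → y.1 < z.1 → False := by
    intro x hx y hy z hz j hj1 hj2
    obtain ⟨x', hx', rfl⟩ := Finset.mem_image.1 hx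
    obtain ⟨y', hy', rfl⟩ := Finset.mem_image.1 hy
    obtain ⟨z', hz', rfl⟩ := Finset.mem_image.1 hz
    exact hthree x' hx' y' hy' z' hz' j hj1 hj2
  apply count_bound (B.image ψ) k l h hl hlk hhpos
  · intro b hb
    obtain ⟨b', hb', rfl⟩ := Finset.mem_image.1 hb
    exact htop b' hb'
  · intro b hb
    obtain ⟨b', hb', rfl⟩ := Finset.mem_image.1 hb
    have := hb0min b' hb'
    simp only [ψ]
    linarith
  · exact ⟨ψ p, Finset.mem_image_of_mem _ hp, hpl⟩
  · exact ⟨ψ b0, Finset.mem_image_of_mem _ hb0, by simp only [ψ]; linarith⟩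
  · intro j hj1 hj2
    by_contra hcon
    push Not at hcon
    obtain ⟨x, y, z, hx, hy, hz, hxy, hxz, hyz⟩ := Finset.two_lt_card_iff.1 hcon
    rw [Finset.mem_filter] at hx hy hz
    have ne : ∀ a b : ℤ × ℤ, a.2 = j → b.2 = j → a ≠ b → a.1 < b.1 ∨ b.1 < a.1 := by
      intro a b ha hb hab
      by_contra hc
      exact hab (Prod.ext (by omega) (ha.trans hb.symm))
    have T := fun a b c ha hb hc => hthree' a ha b hb c hc j hj1 hj2
    have t1 := T x y z hx.1 hy.1 hz.1 hx.2 hy.2 hz.2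
    have t2 := T x z y hx.1 hz.1 hy.1 hx.2 hz.2 hy.2
    have t3 := T y x z hy.1 hx.1 hz.1 hy.2 hx.2 hz.2
    have t4 := T y z x hy.1 hz.1 hx.1 hy.2 hz.2 hx.2
    have t5 := T z x y hz.1 hx.1 hy.1 hz.2 hx.2 hy.2
    have t6 := T z y x hz.1 hy.1 hx.1 hz.2 hy.2 hx.2
    have n1 := ne x y hx.2 hy.2 hxy
    have n2 := ne x z hx.2 hz.2 hxz
    have n3 := ne y z hy.2 hz.2 hyz
    clear T ne
    rcases n1 with n1 | n1 <;> rcases n2 with n2 | n2 <;> rcases n3 with n3 | n3 <;>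
      first
      | exact t1 n1 n3
      | exact t2 n2 n3
      | exact t3 n1 n2
      | exact t4 n3 n2
      | exact t5 n2 n1
      | exact t6 n3 n1
      | omega
  · intro P hP P' hP' R hR R' hR' h1 h2 h3 h4
    obtain ⟨P, kP, rfl⟩ := Finset.mem_image.1 hP
    obtain ⟨P', kP', rfl⟩ := Finset.mem_image.1 hP'
    obtain ⟨R, kR, rfl⟩ := Finset.mem_image.1 hR
    obtain ⟨R', kR', rfl⟩ := Finset.mem_image.1 hR'
    have a1 := (hwid P kP R kR h1 h3).2
    have a2 := (hwid P' kP' R' kR' h2 h4).1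
    simp only [ψ]
    linarith
  · rw [Finset.sum_image (fun x _ y _ hxy => hinj hxy)]
    exact hsum

lemma pairQ_toQ (e p : ℤ × ℤ) : pairQ e (toQ p) = ((e.1 * p.1 + e.2 * p.2 : ℤ) : ℚ) := by
  simp [pairQ, toQ]

lemma hull_le (S : Finset (ℤ × ℤ)) (e : ℤ × ℤ) (l : ℤ)
    (h : ∀ s ∈ S, e.1 * s.1 + e.2 * s.2 ≤ l) :
    ∀ y ∈ convexHull ℚ (toQ '' (S : Set (ℤ × ℤ))), pairQ e y ≤ l := by
  have hconv : Convex ℚ {y : ℚ × ℚ | pairQ e y ≤ l} := by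
    intro x hx y hy a b ha hb hab
    simp only [Set.mem_ofPred_eq, pairQ, Prod.fst_add, Prod.snd_add, Prod.smul_fst, Prod.smul_snd,
      smul_eq_mul] at *
    have hb' : b = 1 - a := by linarith
    subst hb'
    nlinarith [mul_le_mul_of_nonneg_left hx ha, mul_le_mul_of_nonneg_left hy hb]
  have hsub : toQ '' (S : Set (ℤ × ℤ)) ⊆ {y : ℚ × ℚ | pairQ e y ≤ l} := by
    rintro _ ⟨s, hs, rfl⟩
    rw [Set.mem_ofPred_eq, pairQ_toQ]
    exact_mod_cast h s hs
  exact fun y hy => convexHull_min hsub hconv hy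

lemma exists_gt_smul_mem (Q : Set (ℚ × ℚ)) (x : ℚ × ℚ) (hx : x ∈ interior Q) :
    ∃ t : ℚ, 1 < t ∧ t • x ∈ Q := by
  have hc : Filter.Tendsto (fun t : ℚ => t • x) (nhds 1) (nhds x) := by
    have : Continuous (fun t : ℚ => t • x) := by fun_prop
    simpa using this.tendsto 1
  have h1 : ∀ᶠ t in nhds (1 : ℚ), t • x ∈ Q := hc (mem_interior_iff_mem_nhds.1 hx)
  have h2 : ∀ᶠ t in nhdsWithin (1 : ℚ) (Set.Ioi 1), t • x ∈ Q := h1.filter_mono nhdsWithin_le_nhds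
  obtain ⟨t, ht1, ht2⟩ := (h2.and self_mem_nhdsWithin).exists
  exact ⟨t, ht2, ht1⟩

lemma exists_pos_smul_mem (Q : Set (ℚ × ℚ)) (x : ℚ × ℚ) (hQ : 0 ∈ interior Q) :
    ∃ t : ℚ, 0 < t ∧ t • x ∈ Q := by
  have hc : Filter.Tendsto (fun t : ℚ => t • x) (nhds 0) (nhds 0) := by
    have : Continuous (fun t : ℚ => t • x) := by fun_prop
    simpa using this.tendsto 0
  have h1 : ∀ᶠ t in nhds (0 : ℚ), t • x ∈ Q := hc (mem_interior_iff_mem_nhds.1 hQ)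
  have h2 : ∀ᶠ t in nhdsWithin (0 : ℚ) (Set.Ioi 0), t • x ∈ Q := h1.filter_mono nhdsWithin_le_nhds
  obtain ⟨t, ht1, ht2⟩ := (h2.and self_mem_nhdsWithin).exists
  exact ⟨t, ht2, ht1⟩

lemma smul_mem_interior (Q : Set (ℚ × ℚ)) (hconv : Convex ℚ Q) (h0 : (0 : ℚ × ℚ) ∈ interior Q)
    (w : ℚ × ℚ) (hw : w ∈ Q) (t : ℚ) (ht : 0 ≤ t) (ht1 : t < 1) : t • w ∈ interior Q := by
  have := hconv.combo_interior_self_mem_interior h0 hw (a := 1 - t) (b := t) (by linarith) ht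
    (by ring)
  simpa using this

lemma closure_le (Q : Set (ℚ × ℚ)) (e : ℤ × ℤ) (l : ℤ) (h : ∀ y ∈ Q, pairQ e y ≤ l) :
    ∀ y ∈ closure Q, pairQ e y ≤ l := by
  have hcl : IsClosed {y : ℚ × ℚ | pairQ e y ≤ l} := by
    apply isClosed_le _ continuous_const
    unfold pairQ
    fun_prop
  exact fun y hy => closure_minimal (fun z hz => h z hz) hcl hy

/-- If `Q` is an IP-polygon of maximal local index `m_Q = k ≥ 2`, then
`|∂Q ∩ ℤ²| ≤ 4k(k + 2)`. -/
theorem boundary_lattice_points_bound_IP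
    (Q : Set (ℚ × ℚ)) (k : ℤ) (hQ : IsIPPolygon Q) (hk : 2 ≤ k)
    (hmax : HasMaxLocalIndex Q k) :
    (latticeCount (frontier Q) : ℤ) ≤ 4 * k * (k + 2) := by
  obtain ⟨⟨⟨S, hS⟩, -⟩, h0⟩ := hQ
  have hconv : Convex ℚ Q := hS ▸ convex_convexHull ℚ _
  have hSQ : ∀ s ∈ S, toQ s ∈ Q := by
    intro s hs
    rw [hS]
    exact subset_convexHull ℚ _ ⟨s, hs, rfl⟩
  have hle : ∀ (e : ℤ × ℤ) (l : ℤ), (∀ s ∈ S, e.1 * s.1 + e.2 * s.2 ≤ l) →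
      ∀ y ∈ Q, pairQ e y ≤ l := by
    intro e l h y hy
    rw [hS] at hy
    exact hull_le S e l h y hy
  have hpos : ∀ a b : ℤ, (a, b) ≠ (0, 0) → ∃ s ∈ S, 0 < a * s.1 + b * s.2 := by
    intro a b hab
    by_contra hcon
    push Not at hcon
    obtain ⟨t, ht, htQ⟩ := exists_pos_smul_mem Q ((a : ℚ), (b : ℚ)) h0
    have h1 := hle (a, b) 0 hcon _ htQ
    simp only [pairQ, Prod.smul_fst, Prod.smul_snd, smul_eq_mul, Int.cast_zero] at h1
    have h2 : t * ((a : ℚ) ^ 2 + (b : ℚ) ^ 2) ≤ 0 := by linarith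
    have h3 : (a : ℚ) ^ 2 + (b : ℚ) ^ 2 ≤ 0 := by
      by_contra hc
      push Not at hc
      nlinarith [mul_pos ht hc]
    have ha : (a : ℚ) = 0 := by nlinarith [sq_nonneg (a : ℚ), sq_nonneg (b : ℚ)]
    have hb : (b : ℚ) = 0 := by nlinarith [sq_nonneg (a : ℚ), sq_nonneg (b : ℚ)]
    apply hab
    rw [Prod.mk.injEq]
    exact ⟨by exact_mod_cast ha, by exact_mod_cast hb⟩
  unfold latticeCount
  by_cases hfin : {p : ℤ × ℤ | toQ p ∈ frontier Q}.Finite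
  swap
  · rw [Set.Infinite.ncard hfin]
    push_cast
    nlinarith
  rw [Set.ncard_eq_toFinset_card _ hfin]
  have hmem : ∀ b, b ∈ hfin.toFinset ↔ toQ b ∈ frontier Q := by
    intro b; simp
  apply core_bound
  · rw [hmem]
    intro h
    apply h.2
    have : toQ 0 = 0 := by simp [toQ]
    rw [this]; exact h0
  intro v hv
  obtain ⟨p, hp, q, hq, hD, hα, hβ, hsup⟩ := exists_edge S v hv hpos
  -- the primitive normal
  set n1 := q.2 - p.2 with hn1
  set n2 := p.1 - q.1 with hn2
  have hval : ∀ s : ℤ × ℤ, n1 * s.1 + n2 * s.2 = dt s q + dt p s := by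
    intro s; simp only [dt, hn1, hn2]; ring
  have hvp : n1 * p.1 + n2 * p.2 = dt p q := by simp only [dt, hn1, hn2]; ring
  have hvq : n1 * q.1 + n2 * q.2 = dt p q := by simp only [dt, hn1, hn2]; ring
  have hgpos : 0 < Int.gcd n1 n2 := by
    rw [Int.gcd_pos_iff]
    by_contra hc
    push Not at hc
    rw [hc.1, hc.2] at hvp
    simp at hvp
    omega
  obtain ⟨e1, e2, hcop, he1, he2⟩ := Int.exists_gcd_one hgpos
  generalize Int.gcd n1 n2 = g at hgpos he1 he2
  have hg : (0 : ℤ) < g := by exact_mod_cast hgpos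
  obtain ⟨l, hl⟩ : ∃ l, l = e1 * p.1 + e2 * p.2 := ⟨_, rfl⟩
  have hlD : dt p q = l * g := by rw [← hvp, he1, he2, hl]; ring
  have hlpos : 0 < l := by
    by_contra hc
    push Not at hc
    nlinarith
  have hql : e1 * q.1 + e2 * q.2 = l := by
    have : (e1 * q.1 + e2 * q.2) * g = l * g := by rw [← hlD, ← hvq, he1, he2]; ring
    exact mul_right_cancel₀ hg.ne' this
  have hSl : ∀ s ∈ S, e1 * s.1 + e2 * s.2 ≤ l := by
    intro s hs
    have h1 := hsup s hs
    rw [← hval, hlD, he1, he2] at h1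
    have : (e1 * s.1 + e2 * s.2) * g ≤ l * g := by linarith
    exact le_of_mul_le_mul_right this hg
  have hQl : ∀ y ∈ Q, pairQ (e1, e2) y ≤ l := hle (e1, e2) l hSl
  have hpne : toQ p ≠ toQ q := by
    intro h
    simp only [toQ, Prod.mk.injEq, Int.cast_inj] at h
    unfold dt at hD
    rw [h.1, h.2] at hD
    linarith [mul_comm q.1 q.2]
  have hlk : l ≤ k := by
    refine hmax.2 _ (e1, e2) l ⟨hcop, hlpos, hQl, rfl, toQ p, ⟨hSQ p hp, ?_⟩, toQ q,
      ⟨hSQ q hq, ?_⟩, hpne⟩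
    · rw [pairQ_toQ, hl]
    · rw [pairQ_toQ, ← hql]
  have hfr : ∀ s ∈ S, e1 * s.1 + e2 * s.2 = l → toQ s ∈ frontier Q := by
    intro s hs hsl
    refine ⟨subset_closure (hSQ s hs), fun hint => ?_⟩
    obtain ⟨t, ht, htQ⟩ := exists_gt_smul_mem Q _ hint
    have h1 := hQl _ htQ
    have h2 : pairQ (e1, e2) (t • toQ s) = t * pairQ (e1, e2) (toQ s) := by
      simp only [pairQ, Prod.smul_fst, Prod.smul_snd, smul_eq_mul]; ring
    rw [h2, pairQ_toQ, hsl] at h1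
    have : (0 : ℚ) < l := by exact_mod_cast hlpos
    nlinarith
  have hv1 : dt p q * v.1 = dt v q * p.1 + dt p v * q.1 := by unfold dt; ring
  have hv2 : dt p q * v.2 = dt v q * p.2 + dt p v * q.2 := by unfold dt; ring
  have hev : dt p q * (e1 * v.1 + e2 * v.2) = (dt v q + dt p v) * l := by
    linear_combination e1 * hv1 + e2 * hv2 + dt v q * hl.symm + dt p v * hql
  have hevpos : 0 < e1 * v.1 + e2 * v.2 := by
    by_contra hc
    push Not at hc
    nlinarith [mul_pos (add_pos_of_pos_of_nonneg hα hβ) hlpos]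
  have hcl := closure_le Q (e1, e2) l hQl
  have hBl : ∀ b ∈ hfin.toFinset, e1 * b.1 + e2 * b.2 ≤ l := by
    intro b hb
    have := hcl _ ((hmem b).1 hb).1
    rw [pairQ_toQ] at this
    exact_mod_cast this
  refine ⟨e1, e2, l, p, (hmem p).2 (hfr p hp hl.symm), q, (hmem q).2 (hfr q hq hql),
    dt v q, dt p v, dt p q, ?_, hlpos, hlk, hBl, hl.symm, hql, hα.le, hβ, hD, hv1, hv2, hevpos, ?_⟩
  · have := Int.gcd_eq_gcd_ab e1 e2
    rw [hcop] at this
    exact ⟨_, _, this.symm⟩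
  · intro hvB
    by_contra hne
    have hlt : e1 * v.1 + e2 * v.2 < l := lt_of_le_of_ne (hBl v hvB) hne
    apply ((hmem v).1 hvB).2
    have hab : dt v q + dt p v < dt p q := by
      by_contra hc
      push Not at hc
      nlinarith
    set a : ℚ := (dt v q : ℚ) with ha
    set b : ℚ := (dt p v : ℚ) with hb
    set d : ℚ := (dt p q : ℚ) with hd
    have ha0 : 0 < a := by rw [ha]; exact_mod_cast hα
    have hb0 : 0 ≤ b := by rw [hb]; exact_mod_cast hβ
    have hd0 : 0 < d := by rw [hd]; exact_mod_cast hD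
    have habd : a + b < d := by rw [ha, hb, hd]; exact_mod_cast hab
    have hw : (a / (a + b)) • toQ p + (b / (a + b)) • toQ q ∈ Q :=
      hconv (hSQ p hp) (hSQ q hq) (by positivity) (by positivity) (by field_simp)
    have hin := smul_mem_interior Q hconv h0 _ hw ((a + b) / d) (by positivity)
      (by rw [div_lt_one hd0]; exact habd)
    have hveq : ((a + b) / d) • ((a / (a + b)) • toQ p + (b / (a + b)) • toQ q) = toQ v := by
      have q1 : d * (v.1 : ℚ) = a * p.1 + b * q.1 := by rw [ha, hb, hd]; exact_mod_cast hv1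
      have q2 : d * (v.2 : ℚ) = a * p.2 + b * q.2 := by rw [ha, hb, hd]; exact_mod_cast hv2
      have hab0 : a + b ≠ 0 := by positivity
      apply Prod.ext
      · simp only [toQ, Prod.smul_fst, Prod.fst_add, smul_eq_mul]
        field_simp
        linarith
      · simp only [toQ, Prod.smul_snd, Prod.snd_add, smul_eq_mul]
        field_simp
        linarith
    rw [← hveq]
    exact hin
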